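/- arXiv:2403.10665 — 8 statements merged into one kernel-verified Lean document; each statement's English description precedes it below -/
import Mathlib

section
/- Let n ≥ 3 and let r, s, r', s' be integers with 2 ≤ r ≤ s, 2 ≤ r' ≤ s', r + s − 1 = n = r' + s' − 1, and r < r'. If ρ > 1 is a real number satisfying ρ^n − ρ^{n−r} − ρ^{n−s} = 0 and ρ' > 1 is a real number satisfying ρ'^n − ρ'^{n−r'} − ρ'^{n−s'} = 0, then ρ > ρ'. -/
/-- Among ∞-digraphs of fixed order n, the spectral radius strictly decreases
as the smaller cycle length r increases. -/
theorem infty_spectral_radius_order (n r s r' s' : ℕ)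
    (hn : 3 ≤ n)
    (hr : 2 ≤ r) (hrs : r ≤ s) (hr' : 2 ≤ r') (hrs' : r' ≤ s')
    (h1 : r + s - 1 = n) (h2 : r' + s' - 1 = n) (hrr' : r < r')
    (ρ ρ' : ℝ) (hρ : 1 < ρ) (hρ' : 1 < ρ')
    (h : ρ ^ n - ρ ^ (n - r) - ρ ^ (n - s) = 0)
    (h' : ρ' ^ n - ρ' ^ (n - r') - ρ' ^ (n - s') = 0) :
    ρ' < ρ := by
  by_contra! hle
  obtain ⟨a, b, k, e1, e2, e3, e4, hab, hk⟩ : ∃ a b k : ℕ, n - s = a ∧ n - r = b + k ∧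
      n - s' = a + k ∧ n - r' = b ∧ a < b ∧ k ≠ 0 :=
    ⟨r - 1, s' - 1, r' - r, by omega, by omega, by omega, by omega, by omega, by omega⟩
  have ha : a ≤ n := by omega
  have hb : b + k ≤ n := by omega
  rw [e1, e2] at h
  rw [e3, e4] at h'
  have hp : 0 < (ρ' ^ k - 1) * (ρ' ^ b - ρ' ^ a) :=
    mul_pos (sub_pos.2 (one_lt_pow₀ hρ' hk)) (sub_pos.2 (pow_lt_pow_right₀ hρ' hab))
  have ht : 1 ≤ ρ' / ρ := (one_le_div (by linarith)).2 hle
  obtain ⟨t, rfl⟩ : ∃ t, ρ' = t * ρ := ⟨ρ' / ρ, by field_simp⟩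
  rw [mul_div_assoc, div_self (by linarith), mul_one] at ht
  have m1 : t ^ a * ρ ^ a ≤ t ^ n * ρ ^ a :=
    mul_le_mul_of_nonneg_right (pow_le_pow_right₀ ht ha) (by positivity)
  have m2 : t ^ (b + k) * ρ ^ (b + k) ≤ t ^ n * ρ ^ (b + k) :=
    mul_le_mul_of_nonneg_right (pow_le_pow_right₀ ht hb) (by positivity)
  have m3 : t ^ n * ρ ^ n = t ^ n * ρ ^ (b + k) + t ^ n * ρ ^ a := by
    rw [← mul_add]; congr 1; linarith
  rw [← mul_pow] at m1 m2 m3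
  rw [pow_add] at h'
  rw [pow_add (t * ρ)] at m2
  nlinarith
end

section
/- Let n ≥ 3 and let r, s, r', s' be integers with 2 ≤ r ≤ s, 2 ≤ r' ≤ s', r + s − 1 = n = r' + s' − 1, and r < r'. If ρ > 1 is a real number satisfying ρ^n − ρ^{s−1} − ρ^{r−1} − 1 = 0 and ρ' > 1 is a real number satisfying ρ'^n − ρ'^{s'−1} − ρ'^{r'−1} − 1 = 0, then ρ > ρ'. -/
/-- Among Type 1a digraphs of fixed order n, the spectral radius strictly
decreases as r increases. -/
theorem type1a_spectral_radius_order (n r s r' s' : ℕ)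
    (hn : 3 ≤ n)
    (hr : 2 ≤ r) (hrs : r ≤ s) (hr' : 2 ≤ r') (hrs' : r' ≤ s')
    (h1 : r + s - 1 = n) (h2 : r' + s' - 1 = n) (hrr' : r < r')
    (ρ ρ' : ℝ) (hρ : 1 < ρ) (hρ' : 1 < ρ')
    (h : ρ ^ n - ρ ^ (s - 1) - ρ ^ (r - 1) - 1 = 0)
    (h' : ρ' ^ n - ρ' ^ (s' - 1) - ρ' ^ (r' - 1) - 1 = 0) :
    ρ' < ρ := by
  obtain ⟨a, rfl⟩ : ∃ a, r = a + 1 := ⟨r - 1, by omega⟩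
  obtain ⟨d, rfl⟩ : ∃ d, r' = a + d + 1 := ⟨r' - 1 - a, by omega⟩
  obtain ⟨e, rfl⟩ : ∃ e, s' = a + e + 1 := ⟨s' - 1 - a, by omega⟩
  obtain rfl : s = a + e + d + 1 := by omega
  obtain rfl : n = a + (a + e + d) + 1 := by omega
  simp only [Nat.add_sub_cancel] at h h'
  by_contra hc
  have hle : ρ ≤ ρ' := not_lt.mp hc
  have hp : 0 < ρ := by linarith
  have hd : 1 < ρ' ^ d := one_lt_pow₀ hρ' (by omega)
  have he : 1 < ρ' ^ e := one_lt_pow₀ hρ' (by omega)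
  have ha : 0 < ρ' ^ a := by positivity
  have key : 0 < ρ' ^ a * ((ρ' ^ d - 1) * (ρ' ^ e - 1)) :=
    mul_pos ha (mul_pos (by linarith) (by linarith))
  have key2 : ρ' ^ (a + e) + ρ' ^ (a + d) < ρ' ^ (a + e + d) + ρ' ^ a := by
    simp only [pow_add]
    nlinarith [key]
  obtain ⟨t, ht, rfl⟩ : ∃ t, 1 ≤ t ∧ ρ' = t * ρ :=
    ⟨ρ' / ρ, (one_le_div hp).2 hle, by field_simp⟩
  have hb : (t * ρ) ^ (a + e + d) ≤ t ^ (a + (a + e + d) + 1) * ρ ^ (a + e + d) := by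
    rw [mul_pow]
    exact mul_le_mul_of_nonneg_right (pow_le_pow_right₀ ht (by omega)) (by positivity)
  have hA : (t * ρ) ^ a ≤ t ^ (a + (a + e + d) + 1) * ρ ^ a := by
    rw [mul_pow]
    exact mul_le_mul_of_nonneg_right (pow_le_pow_right₀ ht (by omega)) (by positivity)
  have h0 : 1 ≤ t ^ (a + (a + e + d) + 1) := one_le_pow₀ ht
  have hN : (t * ρ) ^ (a + (a + e + d) + 1)
      = t ^ (a + (a + e + d) + 1) * (ρ ^ (a + e + d) + ρ ^ a + 1) := by
    rw [mul_pow]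
    congr 1
    linarith
  rw [mul_add, mul_add] at hN
  linarith
end

section
/- Let n ≥ 3 and let r, s, r', s' be integers with 2 ≤ r ≤ s, 2 ≤ r' ≤ s', r + s − 1 = n = r' + s' − 1, and r < r'. If ρ > 1 is a real number satisfying ρ^n − ρ^{s−1} − ρ^{r−1} − ρ − 2 = 0 and ρ' > 1 is a real number satisfying ρ'^n − ρ'^{s'−1} − ρ'^{r'−1} − ρ' − 2 = 0, then ρ > ρ'. -/
/-- Among Type 2 digraphs of fixed order n, the spectral radius strictly
decreases as r increases. -/
theorem type2_spectral_radius_order (n r s r' s' : ℕ)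
    (hn : 3 ≤ n)
    (hr : 2 ≤ r) (hrs : r ≤ s) (hr' : 2 ≤ r') (hrs' : r' ≤ s')
    (h1 : r + s - 1 = n) (h2 : r' + s' - 1 = n) (hrr' : r < r')
    (ρ ρ' : ℝ) (hρ : 1 < ρ) (hρ' : 1 < ρ')
    (h : ρ ^ n - ρ ^ (s - 1) - ρ ^ (r - 1) - ρ - 2 = 0)
    (h' : ρ' ^ n - ρ' ^ (s' - 1) - ρ' ^ (r' - 1) - ρ' - 2 = 0) :
    ρ' < ρ := by
  by_contra! hle
  obtain ⟨a, ha⟩ : ∃ a, a = r - 1 := ⟨_, rfl⟩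
  obtain ⟨d, hd⟩ : ∃ d, d = r' - r := ⟨_, rfl⟩
  obtain ⟨k, hk⟩ : ∃ k, k = s' - r' := ⟨_, rfl⟩
  have e1 : r - 1 = a := by omega
  have e2 : r' - 1 = a + d := by omega
  have e3 : s' - 1 = a + (d + k) := by omega
  have e4 : s - 1 = a + d + (d + k) := by omega
  rw [e1, e4] at h
  rw [e2, e3] at h'
  have hx : 0 < ρ := by linarith
  have p1 : 1 < ρ ^ d := one_lt_pow₀ hρ (by omega)
  have p2 : 1 < ρ ^ (d + k) := one_lt_pow₀ hρ (by omega)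
  have p3 : 0 < ρ ^ a := by positivity
  have key : 0 < ρ ^ a * ((ρ ^ d - 1) * (ρ ^ (d + k) - 1)) :=
    mul_pos p3 (mul_pos (by linarith) (by linarith))
  have key2 : ρ ^ (a + (d + k)) + ρ ^ (a + d) + ρ + 2 < ρ ^ n := by
    rw [pow_add ρ (a + d) (d + k), pow_add ρ a d] at h
    rw [pow_add ρ a (d + k), pow_add ρ a d]
    nlinarith
  obtain ⟨t, ht⟩ : ∃ t, ρ' = t * ρ := ⟨ρ' / ρ, by field_simp⟩
  have ht1 : 1 ≤ t := by
    by_contra! hlt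
    nlinarith
  have q : ∀ m, m ≤ n → t ^ m * ρ ^ m ≤ t ^ n * ρ ^ m := fun m hm =>
    mul_le_mul_of_nonneg_right (pow_le_pow_right₀ ht1 hm) (by positivity)
  have q1 := q (a + (d + k)) (by omega)
  have q2 := q (a + d) (by omega)
  have q3 := q 1 (by omega)
  have q4 : 1 ≤ t ^ n := one_le_pow₀ ht1
  have q5 := mul_lt_mul_of_pos_left key2 (by linarith : 0 < t ^ n)
  rw [ht, mul_pow, mul_pow, mul_pow] at h'
  rw [pow_one, pow_one] at q3
  linarith
end

section
/- Let k > m > 0 be integers, let d = gcd(k,m), k₁ = k/d, m₁ = m/d. If it is not the case that both k₁ + m₁ ≡ 0 (mod 3) and m₁ ≡ 0 (mod 2), then the polynomial X^k − X^m − 1 is irreducible over ℚ. If both k₁ + m₁ ≡ 0 (mod 3) and m₁ ≡ 0 (mod 2), then there exists an irreducible polynomial g ∈ ℚ[X] such that X^k − X^m − 1 = (X^{2d} − X^d + 1) · g. -/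
open Polynomial

/-- A unit trinomial is determined up to sign and mirror by its product with its mirror. -/
theorem lj_mirror {p q : ℤ[X]} (hp : p.IsUnitTrinomial) (hpq : p * p.mirror = q * q.mirror) :
    q = p ∨ q = -p ∨ q = p.mirror ∨ q = -p.mirror := by
  have hq : IsUnitTrinomial q := (isUnitTrinomial_iff'' hpq).mp hp
  obtain ⟨k, m, n, hkm, hmn, u, v, w, hp⟩ := hp
  obtain ⟨k', m', n', hkm', hmn', x, y, z, hq⟩ := hq
  have hk : k = k' := by
    rw [← mul_right_inj' (show 2 ≠ 0 from two_ne_zero), ←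
      trinomial_natTrailingDegree hkm hmn u.ne_zero, ← hp, ← natTrailingDegree_mul_mirror, hpq,
      natTrailingDegree_mul_mirror, hq, trinomial_natTrailingDegree hkm' hmn' x.ne_zero]
  have hn : n = n' := by
    rw [← mul_right_inj' (show 2 ≠ 0 from two_ne_zero), ← trinomial_natDegree hkm hmn w.ne_zero, ←
      hp, ← natDegree_mul_mirror, hpq, natDegree_mul_mirror, hq,
      trinomial_natDegree hkm' hmn' z.ne_zero]
  subst hk
  subst hn
  rcases eq_or_eq_neg_of_sq_eq_sq (y : ℤ) (v : ℤ)
      ((Int.isUnit_sq y.isUnit).trans (Int.isUnit_sq v.isUnit).symm) with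
    (h1 | h1)
  · rw [h1] at hq
    rcases IsUnitTrinomial.irreducible_aux3 hkm hmn hkm' hmn' u v w x z hp hq hpq with (h2 | h2)
    · exact Or.inl h2
    · exact Or.inr (Or.inr (Or.inl h2))
  · rw [h1] at hq
    rw [trinomial_def] at hp
    rw [← neg_inj, neg_add, neg_add, ← neg_mul, ← neg_mul, ← neg_mul, ← C_neg, ← C_neg, ← C_neg]
      at hp
    rw [← neg_mul_neg, ← mirror_neg] at hpq
    rcases IsUnitTrinomial.irreducible_aux3 hkm hmn hkm' hmn' (-u) (-v) (-w) x z hp hq hpq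
      with (rfl | rfl)
    · exact Or.inr (Or.inl rfl)
    · exact Or.inr (Or.inr (Or.inr p.mirror_neg))

theorem lj_irred {H g : ℤ[X]} (hp : (H * g).IsUnitTrinomial) (hH : H.mirror = H)
    (hg : ¬ IsUnit g) (hrel : IsRelPrime g g.mirror) : Irreducible g := by
  refine ⟨hg, ?_⟩
  intro a b hab
  have h0 : H * g ≠ 0 := hp.ne_zero
  have hH0 : H ≠ 0 := left_ne_zero_of_mul h0
  have hg0 : g ≠ 0 := right_ne_zero_of_mul h0
  have ha0 : a ≠ 0 := by rintro rfl; simp at hab; exact hg0 hab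
  have hb0 : b ≠ 0 := by rintro rfl; simp at hab; exact hg0 hab
  have hbm0 : b.mirror ≠ 0 := by rwa [Ne, mirror_eq_zero]
  have hgm : g.mirror = a.mirror * b.mirror := by rw [hab, mirror_mul_of_domain]
  have key := lj_mirror (q := H * (a * b.mirror)) hp (by
    simp only [mirror_mul_of_domain, mirror_mirror, hH, hgm]
    rw [hab]; ring)
  have hbu : b.mirror = b ∨ b.mirror = -b → IsUnit b := by
    intro h
    apply hrel
    · rw [hab]; exact dvd_mul_left _ _
    · rw [hgm]
      apply dvd_mul_of_dvd_right
      rcases h with h | h <;> rw [h]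
      exact (dvd_neg).2 dvd_rfl
  have hau : a = a.mirror ∨ a = -a.mirror → IsUnit a := by
    intro h
    apply hrel
    · rw [hab]; exact dvd_mul_right _ _
    · rw [hgm]
      apply dvd_mul_of_dvd_left
      rcases h with h | h
      · rw [← h]
      · rw [h, neg_dvd]; simp [← h]
  rw [mirror_mul_of_domain, hH, hgm, ← mul_neg, ← mul_neg, mul_right_inj' hH0,
    mul_right_inj' hH0, mul_right_inj' hH0, mul_right_inj' hH0, hab, ← mul_neg, ← neg_mul,
    mul_right_inj' ha0, mul_right_inj' ha0, mul_left_inj' hbm0, mul_left_inj' hbm0] at key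
  rcases key with h | h | h | h
  · exact Or.inr (hbu (Or.inl h))
  · exact Or.inr (hbu (Or.inr h))
  · exact Or.inl (hau (Or.inl h))
  · exact Or.inl (hau (Or.inr h))

theorem lj_relprime {g : ℤ[X]} (hg : g.Monic)
    (h : ∀ z : ℂ, ¬ (aeval z g = 0 ∧ aeval z g.mirror = 0)) : IsRelPrime g g.mirror := by
  intro c hc hc'
  have hlc : IsUnit c.leadingCoeff := by
    obtain ⟨e, he⟩ := hc
    have := congrArg leadingCoeff he
    rw [hg.leadingCoeff, leadingCoeff_mul] at this
    exact IsUnit.of_mul_eq_one _ this.symm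
  by_contra hu
  have hdeg : c.natDegree ≠ 0 := by
    intro h0
    apply hu
    rw [eq_C_of_natDegree_eq_zero h0]
    apply isUnit_C.2
    rwa [leadingCoeff, h0] at hlc
  obtain ⟨z, hz⟩ := Complex.exists_root (f := c.map (Int.castRingHom ℂ)) (by
    rw [degree_map_eq_of_injective Int.cast_injective]
    exact natDegree_pos_iff_degree_pos.1 (Nat.pos_of_ne_zero hdeg))
  have hz' : aeval z c = 0 := by
    rw [IsRoot, eval_map] at hz
    simpa [aeval_def] using hz
  refine h z ⟨?_, ?_⟩
  · obtain ⟨e, rfl⟩ := hc; simp [hz']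
  · obtain ⟨e, he⟩ := hc'; rw [he]; simp [hz']

theorem lj_dvd {R : Type*} [CommRing R] (x : R) (k m : ℕ) (hc : Nat.Coprime k m)
    (h1 : (k + m) % 3 = 0) (h2 : m % 2 = 0) : x ^ 2 - x + 1 ∣ x ^ k - x ^ m - 1 := by
  have h6 : ∀ n : ℕ, x ^ 2 - x + 1 ∣ x ^ n - x ^ (n % 6) := by
    intro n
    have e : x ^ n - x ^ (n % 6) = x ^ (n % 6) * ((x ^ 6) ^ (n / 6) - 1) := by
      conv_lhs => rw [← Nat.mod_add_div n 6]
      rw [pow_add, pow_mul]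
      simp
      ring
    rw [e]
    apply dvd_mul_of_dvd_right
    exact (Dvd.intro ((x + 1) * (x ^ 3 - 1)) (by ring)).trans (sub_one_dvd_pow_sub_one _ _)
  have hk2 : k % 2 ≠ 0 := fun h => by
    have := Nat.dvd_gcd (Nat.dvd_of_mod_eq_zero h) (Nat.dvd_of_mod_eq_zero h2)
    rw [hc] at this; omega
  have hk3 : k % 3 ≠ 0 := fun h => by
    have := Nat.dvd_gcd (Nat.dvd_of_mod_eq_zero h)
      (Nat.dvd_of_mod_eq_zero (show m % 3 = 0 by omega))
    rw [hc] at this; omega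
  have hcase : (k % 6 = 1 ∧ m % 6 = 2) ∨ (k % 6 = 5 ∧ m % 6 = 4) := by
    have hk : k % 6 = 1 ∨ k % 6 = 5 := by omega
    rcases hk with h | h
    · left; refine ⟨h, ?_⟩; have : m % 3 = 2 := by omega
      omega
    · right; refine ⟨h, ?_⟩; have : m % 3 = 1 := by omega
      omega
  have key : x ^ 2 - x + 1 ∣ x ^ (k % 6) - x ^ (m % 6) - 1 := by
    rcases hcase with ⟨h, h'⟩ | ⟨h, h'⟩ <;> rw [h, h']
    · exact ⟨-1, by ring⟩
    · exact ⟨x ^ 3 - x - 1, by ring⟩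
  have := dvd_add (dvd_sub (h6 k) (h6 m)) key
  convert this using 1
  ring

theorem lj_root (y : ℂ) (k m : ℕ) (hc : Nat.Coprime k m)
    (h1 : y ^ k = y ^ m + 1) (h2 : (y ^ m) ^ 2 + y ^ m + 1 = 0) :
    y ^ 2 - y + 1 = 0 ∧ (k + m) % 3 = 0 ∧ m % 2 = 0 := by
  have hb : (y ^ k) ^ 2 = y ^ m := by rw [h1]; linear_combination h2
  have hb1 : (y ^ k) ^ 2 - y ^ k + 1 = 0 := by rw [hb, h1]; ring
  have hb3 : (y ^ k) ^ 3 = -1 := by linear_combination (y ^ k + 1) * hb1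
  have hb6 : (y ^ k) ^ 6 = 1 := by linear_combination ((y ^ k) ^ 3 - 1) * hb3
  have ha6 : (y ^ m) ^ 6 = 1 := by
    rw [← hb]; linear_combination ((y ^ k) ^ 6 + 1) * hb6
  have y6 : y ^ 6 = 1 := by
    rw [← pow_mul] at hb6 ha6
    have := Nat.dvd_gcd (orderOf_dvd_of_pow_eq_one hb6) (orderOf_dvd_of_pow_eq_one ha6)
    rw [Nat.gcd_mul_right, hc, one_mul] at this
    exact orderOf_dvd_iff_pow_eq_one.1 this
  have hmod : ∀ n : ℕ, y ^ n = y ^ (n % 6) := by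
    intro n
    conv_lhs => rw [← Nat.mod_add_div n 6]
    rw [pow_add, pow_mul, y6]; simp
  have hk2 : k % 2 ≠ 0 := fun h => by
    obtain ⟨c, rfl⟩ := Nat.dvd_of_mod_eq_zero h
    have : (y ^ (2 * c)) ^ 3 = 1 := by
      rw [← pow_mul, show 2 * c * 3 = 6 * c by ring, pow_mul, y6, one_pow]
    rw [this] at hb3; norm_num at hb3
  have hk3 : k % 3 ≠ 0 := fun h => by
    obtain ⟨c, rfl⟩ := Nat.dvd_of_mod_eq_zero h
    have : (y ^ (3 * c)) ^ 2 = 1 := by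
      rw [← pow_mul, show 3 * c * 2 = 6 * c by ring, pow_mul, y6, one_pow]
    rw [← hb, this] at h2; norm_num at h2
  have hy : y ^ 2 - y + 1 = 0 := by
    rw [hmod k] at hb1
    have : k % 6 = 1 ∨ k % 6 = 5 := by omega
    rcases this with h | h <;> rw [h] at hb1
    · simpa using hb1
    · linear_combination y ^ 2 * hb1 + (y - y ^ 6 - 1) * y6
  have hy0 : y ≠ 0 := by rintro rfl; norm_num at hy
  have hy1 : y ≠ 1 := by rintro rfl; norm_num at hy
  have ho : orderOf y = 6 := by
    have hd : orderOf y ∣ 6 := orderOf_dvd_of_pow_eq_one y6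
    have n3 : y ^ 3 ≠ 1 := by
      intro h
      have : (2 : ℂ) = 0 := by linear_combination (y + 1) * hy - h
      norm_num at this
    have n2 : y ^ 2 ≠ 1 := by
      intro h
      have : (3 : ℂ) = 0 := by linear_combination (y + 2) * hy - (y+1) * h
      norm_num at this
    have hle := Nat.le_of_dvd (by norm_num) hd
    have hp := pow_orderOf_eq_one y
    interval_cases h : orderOf y
    all_goals first | rfl | (exfalso; revert hd; norm_num; done) | simp_all
  have hcong : y ^ (k * 2) = y ^ m := by rw [pow_mul, hb]
  rw [hmod (k * 2), hmod m] at hcong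
  have hpr : IsPrimitiveRoot y 6 := ho ▸ IsPrimitiveRoot.orderOf y
  have hcong := hpr.pow_inj (Nat.mod_lt _ (by norm_num)) (Nat.mod_lt _ (by norm_num)) hcong
  refine ⟨hy, ?_, ?_⟩ <;> omega

theorem lj_final (d k₁ m₁ : ℕ) (hd : 0 < d) (hm : 0 < m₁) (hkm : m₁ < k₁)
    (hc : Nat.Coprime k₁ m₁) :
    (¬((k₁ + m₁) % 3 = 0 ∧ m₁ % 2 = 0) →
      Irreducible ((X : Polynomial ℚ) ^ (d * k₁) - X ^ (d * m₁) - 1)) ∧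
    (((k₁ + m₁) % 3 = 0 ∧ m₁ % 2 = 0) →
      ∃ g : Polynomial ℚ, Irreducible g ∧
        (X : Polynomial ℚ) ^ (d * k₁) - X ^ (d * m₁) - 1 = (X ^ (2 * d) - X ^ d + 1) * g) := by
  have hdm : 0 < d * m₁ := Nat.mul_pos hd hm
  have hdk : d * m₁ < d * k₁ := Nat.mul_lt_mul_of_pos_left hkm hd
  have hf : (X ^ (d * k₁) - X ^ (d * m₁) - 1 : ℤ[X])
      = trinomial 0 (d * m₁) (d * k₁) ((-1 : ℤˣ) : ℤ) ((-1 : ℤˣ) : ℤ) ((1 : ℤˣ) : ℤ) := by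
    simp only [trinomial, Units.val_neg, Units.val_one, C_neg, C_1]; ring
  have hmon : (X ^ (d * k₁) - X ^ (d * m₁) - 1 : ℤ[X]).Monic := by
    rw [hf]; exact trinomial_monic hdm hdk
  have htri : (X ^ (d * k₁) - X ^ (d * m₁) - 1 : ℤ[X]).IsUnitTrinomial :=
    ⟨_, _, _, hdm, hdk, _, _, _, hf⟩
  have hmir : (X ^ (d * k₁) - X ^ (d * m₁) - 1 : ℤ[X]).mirror
      = 1 - X ^ (d * k₁ - d * m₁) - X ^ (d * k₁) := by
    rw [hf, trinomial_mirror hdm hdk (-1 : ℤˣ).ne_zero (1 : ℤˣ).ne_zero]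
    simp only [trinomial, Units.val_neg, Units.val_one, C_neg, C_1]; ring
  have hroot : ∀ z : ℂ, aeval z (X ^ (d * k₁) - X ^ (d * m₁) - 1 : ℤ[X]) = 0 →
      aeval z (X ^ (d * k₁) - X ^ (d * m₁) - 1 : ℤ[X]).mirror = 0 →
      (z ^ d) ^ k₁ = (z ^ d) ^ m₁ + 1 ∧ ((z ^ d) ^ m₁) ^ 2 + (z ^ d) ^ m₁ + 1 = 0 := by
    intro z h1 h2
    rw [hmir] at h2
    simp only [map_sub, map_pow, aeval_X, map_one] at h1 h2
    have e : z ^ (d * k₁ - d * m₁) * z ^ (d * m₁) = z ^ (d * k₁) := by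
      rw [← pow_add, Nat.sub_add_cancel hdk.le]
    simp only [← pow_mul]
    refine ⟨by linear_combination h1, ?_⟩
    linear_combination (-z ^ (d * m₁)) * h2 - e - (1 + z ^ (d * m₁)) * h1
  constructor
  · intro hn
    have : Irreducible (X ^ (d * k₁) - X ^ (d * m₁) - 1 : ℤ[X]) := by
      apply lj_irred (H := 1) (by rwa [one_mul]) (by rw [← C_1, mirror_C]) htri.not_isUnit
      apply lj_relprime hmon
      rintro z ⟨h1, h2⟩
      obtain ⟨h3, h4⟩ := hroot z h1 h2
      exact hn (lj_root _ _ _ hc h3 h4).2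
    have := (IsPrimitive.Int.irreducible_iff_irreducible_map_cast hmon.isPrimitive).1 this
    simpa using this
  · rintro ⟨c1, c2⟩
    obtain ⟨g, hg⟩ := lj_dvd (X ^ d : ℤ[X]) k₁ m₁ hc c1 c2
    rw [← pow_mul, ← pow_mul, ← pow_mul] at hg
    have hH : (X ^ (d * 2) - X ^ d + 1 : ℤ[X])
        = trinomial 0 d (d * 2) 1 (-1) 1 := by
      simp only [trinomial, C_neg, C_1]; ring
    have hHmon : (X ^ (d * 2) - X ^ d + 1 : ℤ[X]).Monic := by
      rw [hH]; exact trinomial_monic hd (by omega)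
    have hHmir : (X ^ (d * 2) - X ^ d + 1 : ℤ[X]).mirror = X ^ (d * 2) - X ^ d + 1 := by
      rw [hH, trinomial_mirror hd (by omega) one_ne_zero one_ne_zero]
      congr 1; omega
    have hgmon : g.Monic := hHmon.of_mul_monic_left (hg ▸ hmon)
    have hgu : ¬ IsUnit g := by
      intro hu
      have hg1 := hgmon.eq_one_of_isUnit hu
      have hdeg := congrArg natDegree hg
      rw [hg1, mul_one, hf, hH, trinomial_natDegree hdm hdk (by simp),
        trinomial_natDegree hd (by omega) (by simp)] at hdeg
      have := Nat.eq_of_mul_eq_mul_left hd hdeg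
      omega
    have hirr : Irreducible g := by
      apply lj_irred (hg ▸ htri) hHmir hgu
      apply lj_relprime hgmon
      rintro z ⟨h1, h2⟩
      obtain ⟨h3, h4⟩ := hroot z (by rw [hg, map_mul, h1, mul_zero])
        (by rw [hg, mirror_mul_of_domain, map_mul, h2, mul_zero])
      have h5 := (lj_root _ _ _ hc h3 h4).1
      have hder := congrArg (fun p => aeval z (derivative p)) hg
      have hHz : z ^ (d * 2) - z ^ d + 1 = 0 := by rw [pow_mul]; exact h5
      have hd0 : aeval z (derivative (X ^ (d * k₁) - X ^ (d * m₁) - 1 : ℤ[X])) = 0 := by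
        rw [hg, derivative_mul, map_add, map_mul, map_mul, h1]
        simp [hHz]
      have hd1 : ((d * k₁ : ℕ) : ℂ) * z ^ (d * k₁) - ((d * m₁ : ℕ) : ℂ) * z ^ (d * m₁) = 0 := by
        have e1 : z ^ (d * k₁) = z ^ (d * k₁ - 1) * z := by
          rw [← pow_succ, Nat.sub_add_cancel (by omega)]
        have e2 : z ^ (d * m₁) = z ^ (d * m₁ - 1) * z := by
          rw [← pow_succ, Nat.sub_add_cancel (by omega)]
        simp [derivative_X_pow] at hd0
        rw [e1, e2]; push_cast
        linear_combination z * hd0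
      rw [pow_mul, pow_mul, h3] at hd1
      generalize (z ^ d) ^ m₁ = a at h4 hd1
      generalize d * k₁ = K at *
      generalize d * m₁ = M at *
      have : ((K : ℂ) - M) * a = - K := by linear_combination hd1
      have h6 : (K : ℂ) ^ 2 - K * (K - M) + (K - M) ^ 2 = 0 := by
        linear_combination ((K : ℂ) - M) ^ 2 * h4 - (((K : ℂ) - M) * a - K + (K - M)) * this
      have h7 : (K : ℤ) ^ 2 - K * (K - M) + (K - M) ^ 2 = 0 := by exact_mod_cast h6
      have : (0 : ℤ) < M := by exact_mod_cast hdm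
      have : (M : ℤ) < K := by exact_mod_cast hdk
      nlinarith
    refine ⟨g.map (Int.castRingHom ℚ),
      (IsPrimitive.Int.irreducible_iff_irreducible_map_cast hgmon.isPrimitive).1 hirr, ?_⟩
    have := congrArg (Polynomial.map (Int.castRingHom ℚ)) hg
    rw [mul_comm 2 d]
    simpa using this

/-- Ljunggren's theorem (special case): for k > m > 0, with d = gcd(k,m),
k₁ = k/d, m₁ = m/d, the trinomial X^k − X^m − 1 is irreducible over ℚ unless
k₁ + m₁ ≡ 0 (mod 3) and m₁ ≡ 0 (mod 2), in which case it factors as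
(X^{2d} − X^d + 1) times an irreducible polynomial. -/
theorem ljunggren_trinomial (k m d k₁ m₁ : ℕ)
    (hm : 0 < m) (hkm : m < k)
    (hd : d = Nat.gcd k m) (hk₁ : k₁ = k / d) (hm₁ : m₁ = m / d) :
    (¬((k₁ + m₁) % 3 = 0 ∧ m₁ % 2 = 0) →
      Irreducible ((X : Polynomial ℚ) ^ k - X ^ m - 1)) ∧
    (((k₁ + m₁) % 3 = 0 ∧ m₁ % 2 = 0) →
      ∃ g : Polynomial ℚ, Irreducible g ∧
        (X : Polynomial ℚ) ^ k - X ^ m - 1 = (X ^ (2 * d) - X ^ d + 1) * g) := by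
  have hd0 : 0 < d := by rw [hd]; exact Nat.gcd_pos_of_pos_right _ hm
  have ek : k = d * k₁ := by
    rw [hk₁, Nat.mul_div_cancel' (by rw [hd]; exact Nat.gcd_dvd_left _ _)]
  have em : m = d * m₁ := by
    rw [hm₁, Nat.mul_div_cancel' (by rw [hd]; exact Nat.gcd_dvd_right _ _)]
  have hc : Nat.Coprime k₁ m₁ := by
    rw [hk₁, hm₁, hd]; exact Nat.coprime_div_gcd_div_gcd (hd ▸ hd0)
  have := lj_final d k₁ m₁ hd0
    (Nat.pos_of_ne_zero (by rintro h; rw [h] at em; omega))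
    (by rw [ek, em] at hkm; exact Nat.lt_of_mul_lt_mul_left hkm) hc
  rwa [← ek, ← em] at this
end

section
/- Let k > m > 0 and k' > m' > 0 be integers and let d = gcd(k,m). If the identity (X^{2d} − X^d + 1) · (X^{k'} − X^{m'} − 1) = X^k − X^m − 1 holds in ℚ[X], then k = 5d, m = 4d, k' = 3d, and m' = d. -/
open Polynomial

/-- If (X^{2d} − X^d + 1)(X^{k'} − X^{m'} − 1) = X^k − X^m − 1 in ℚ[X],
where d = gcd(k,m), then k = 5d, m = 4d, k' = 3d and m' = d. -/
theorem trinomial_factor_trinomial (k m k' m' d : ℕ)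
    (hm : 0 < m) (hkm : m < k) (hm' : 0 < m') (hkm' : m' < k')
    (hd : d = Nat.gcd k m)
    (h : ((X : Polynomial ℚ) ^ (2 * d) - X ^ d + 1) * (X ^ k' - X ^ m' - 1)
          = X ^ k - X ^ m - 1) :
    k = 5 * d ∧ m = 4 * d ∧ k' = 3 * d ∧ m' = d := by
  have hd0 : 0 < d := hd ▸ Nat.gcd_pos_of_pos_right k hm
  clear hd
  have h2 : (X : Polynomial ℚ) ^ (k' + 2 * d) + X ^ k' + X ^ (m' + d) + X ^ d + X ^ m
      = X ^ k + X ^ (k' + d) + X ^ (m' + 2 * d) + X ^ m' + X ^ (2 * d) := by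
    linear_combination h
  have hc : ∀ n : ℕ, (if n = k' + 2 * d then 1 else 0) + (if n = k' then 1 else 0)
      + (if n = m' + d then 1 else 0) + (if n = d then 1 else 0) + (if n = m then 1 else 0)
      = (if n = k then 1 else 0) + (if n = k' + d then 1 else 0)
      + (if n = m' + 2 * d then 1 else 0) + (if n = m' then 1 else 0)
      + (if n = 2 * d then 1 else 0) := by
    intro n
    have h3 := congrArg (fun p => Polynomial.coeff p n) h2
    simp only [coeff_add, coeff_X_pow] at h3
    exact_mod_cast h3
  clear h h2
  have hk : k = k' + 2 * d := by
    have h2 := hc (k' + 2 * d)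
    by_contra hne
    rw [if_neg (show ¬ (k' + 2 * d = k) by omega), if_neg (show ¬ (k' + 2 * d = k' + d) by omega), if_neg (show ¬ (k' + 2 * d = m' + 2 * d) by omega), if_neg (show ¬ (k' + 2 * d = m') by omega), if_neg (show ¬ (k' + 2 * d = 2 * d) by omega)] at h2
    simp only [if_true] at h2
    omega
  subst hk
  have hmd : m' = d := by
    have h1 := hc d
    by_contra hne
    rw [if_neg (show ¬ (d = k' + 2 * d) by omega), if_neg (show ¬ (d = k' + d) by omega), if_neg (show ¬ (d = m' + 2 * d) by omega), if_neg (show ¬ (d = m') by omega), if_neg (show ¬ (d = 2 * d) by omega)] at h1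
    simp only [if_true] at h1
    omega
  subst hmd
  have hk3 : k' = 3 * m' := by
    have h1 := hc k'
    by_contra hne
    rw [if_neg (show ¬ (k' = k' + 2 * m') by omega), if_neg (show ¬ (k' = k' + m') by omega),
      if_neg (show ¬ (k' = m' + 2 * m') by omega), if_neg (show ¬ (k' = m') by omega),
      show m' + m' = 2 * m' by omega] at h1
    simp only [if_true] at h1
    omega
  subst hk3
  have hm4 : m = 4 * m' := by
    have h2 := hc (4 * m')
    by_contra hne
    rw [if_neg (show ¬ (4 * m' = 3 * m' + 2 * m') by omega),
      if_neg (show ¬ (4 * m' = 3 * m') by omega), if_neg (show ¬ (4 * m' = m' + m') by omega),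
      if_neg (show ¬ (4 * m' = m') by omega), if_neg (show ¬ (4 * m' = m) by omega),
      if_pos (show 4 * m' = 3 * m' + m' by omega)] at h2
    omega
  omega
end

section
/- Let k > m > 0 be integers, d = gcd(k,m), k₁ = k/d, m₁ = m/d, and suppose k₁ + m₁ ≡ 0 (mod 3) and m₁ ≡ 0 (mod 2). If g ∈ ℚ[X] satisfies X^k − X^m − 1 = (X^{2d} − X^d + 1) · g, then the coefficient of g in degree 0 equals −1, the coefficient of g in degree d equals −1, and the coefficient of g in every other degree i with 0 < i < 2d, i ≠ d, equals 0 (that is, g ≡ −x^d − 1 modulo x^{2d}). -/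
open Polynomial

/-- If d = gcd(k,m), k₁ = k/d, m₁ = m/d satisfy the reducibility condition and
X^k − X^m − 1 = (X^{2d} − X^d + 1) · g in ℚ[X], then g ≡ −x^d − 1 (mod x^{2d}). -/
theorem cofactor_low_coeffs (k m d k₁ m₁ : ℕ)
    (hm : 0 < m) (hkm : m < k)
    (hd : d = Nat.gcd k m) (hk₁ : k₁ = k / d) (hm₁ : m₁ = m / d)
    (h3 : (k₁ + m₁) % 3 = 0) (h2 : m₁ % 2 = 0)
    (g : Polynomial ℚ)
    (h : (X : Polynomial ℚ) ^ k - X ^ m - 1 = (X ^ (2 * d) - X ^ d + 1) * g) :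
    g.coeff 0 = -1 ∧ g.coeff d = -1 ∧
    ∀ i : ℕ, 0 < i → i < 2 * d → i ≠ d → g.coeff i = 0 := by
  have hd0 : 0 < d := by
    rw [hd]; exact Nat.gcd_pos_of_pos_right _ hm
  have hdm : d ∣ m := by
    rw [hd]; exact Nat.gcd_dvd_right _ _
  obtain ⟨c, hc⟩ := hdm
  have hmc : m₁ = c := by
    rw [hm₁, hc]; exact Nat.mul_div_cancel_left _ hd0
  have hc0 : c ≠ 0 := by
    rintro rfl
    simp at hc
    omega
  have hc2 : 2 ≤ c := by omega
  have h2m : 2 * d ≤ m := by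
    rw [hc, mul_comm]; exact Nat.mul_le_mul_left _ hc2
  have key : ∀ i, i < 2 * d →
      g.coeff i = (if d ≤ i then g.coeff (i - d) else 0) - (if i = 0 then 1 else 0) := by
    intro i hi
    have e := congrArg (fun p => Polynomial.coeff p i) h
    simp only [add_mul, sub_mul, one_mul, coeff_add, coeff_sub, coeff_X_pow_mul', coeff_X_pow,
      coeff_one] at e
    rw [if_neg (by omega : ¬ i = k), if_neg (by omega : ¬ i = m),
      if_neg (by omega : ¬ 2 * d ≤ i)] at e
    linarith
  have h0 : g.coeff 0 = -1 := by
    rw [key 0 (by omega), if_neg (by omega)]; simp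
  have hlow : ∀ i, 0 < i → i < d → g.coeff i = 0 := by
    intro i h1 h2
    rw [key i (by omega), if_neg (by omega), if_neg (by omega)]; simp
  refine ⟨h0, ?_, ?_⟩
  · rw [key d (by omega), if_pos le_rfl, if_neg (by omega), Nat.sub_self, h0]; simp
  · intro i h1 h2 h3
    rcases lt_or_gt_of_ne h3 with h4 | h4
    · exact hlow i h1 h4
    · rw [key i h2, if_pos h4.le, if_neg (by omega), hlow (i - d) (by omega) (by omega)]; simp
end

section
/- Let k > m > 0 and k' > m' > 0 be integers with d = gcd(k,m) and d' = gcd(k',m'), and suppose both pairs satisfy the reducibility condition: (k/d) + (m/d) ≡ 0 (mod 3) and (m/d) ≡ 0 (mod 2), and (k'/d') + (m'/d') ≡ 0 (mod 3) and (m'/d') ≡ 0 (mod 2). If g ∈ ℚ[X] satisfies both X^k − X^m − 1 = (X^{2d} − X^d + 1) · g and X^{k'} − X^{m'} − 1 = (X^{2d'} − X^{d'} + 1) · g, then k = k' and m = m'. -/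
open Polynomial

lemma cof_aux (k m k' m' d d' : ℕ) (hd : 0 < d) (hm : 2 * d ≤ m) (hkm : m < k)
    (hm' : 2 * d' ≤ m') (hkm' : m' < k') (hlt : d < d')
    (g : Polynomial ℚ)
    (h : (X : Polynomial ℚ) ^ k - X ^ m - 1 = (X ^ (2 * d) - X ^ d + 1) * g)
    (h' : (X : Polynomial ℚ) ^ k' - X ^ m' - 1 = (X ^ (2 * d') - X ^ d' + 1) * g) : False := by
  have e : (X : Polynomial ℚ) ^ (k + 2 * d') - X ^ (k + d') + X ^ k - X ^ (m + 2 * d')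
      + X ^ (m + d') - X ^ m - X ^ (2 * d') + X ^ d' - X ^ 0
      = X ^ (k' + 2 * d) - X ^ (k' + d) + X ^ k' - X ^ (m' + 2 * d)
      + X ^ (m' + d) - X ^ m' - X ^ (2 * d) + X ^ d - X ^ 0 := by
    simp only [pow_add, pow_zero]
    linear_combination (X ^ (2 * d') - X ^ d' + 1) * h - (X ^ (2 * d) - X ^ d + 1) * h'
  have c := congrArg (fun p => coeff p d) e
  simp only [coeff_add, coeff_sub, coeff_X_pow] at c
  rw [if_neg (by omega), if_neg (by omega), if_neg (by omega), if_neg (by omega),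
    if_neg (by omega), if_neg (by omega), if_neg (by omega), if_neg (by omega),
    if_neg (by omega), if_neg (by omega), if_neg (by omega), if_neg (by omega),
    if_neg (by omega), if_neg (by omega), if_neg (by omega), if_neg (by omega),
    if_pos trivial] at c
  norm_num at c

lemma cof_aux2 (k m d : ℕ) (hm : 0 < m) (hd : d = Nat.gcd k m) (h2 : (m / d) % 2 = 0) :
    0 < d ∧ 2 * d ≤ m := by
  have hp : 0 < d := hd ▸ Nat.gcd_pos_of_pos_right k hm
  obtain ⟨c, hc⟩ : d ∣ m := hd ▸ Nat.gcd_dvd_right k m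
  refine ⟨hp, ?_⟩
  rw [hc, Nat.mul_div_cancel_left _ hp] at h2
  have : c ≠ 0 := by rintro rfl; simp at hc; omega
  have : 2 ≤ c := by omega
  rw [hc]; nlinarith

/-- The map (k,m) ↦ f̃_{k,m} is injective on reducible pairs: if the same
cofactor g appears in the Ljunggren factorizations of X^k − X^m − 1 and
X^{k'} − X^{m'} − 1, then k = k' and m = m'. -/
theorem cofactor_injective (k m k' m' d d' : ℕ)
    (hm : 0 < m) (hkm : m < k) (hm' : 0 < m') (hkm' : m' < k')
    (hd : d = Nat.gcd k m) (hd' : d' = Nat.gcd k' m')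
    (h3 : (k / d + m / d) % 3 = 0) (h2 : (m / d) % 2 = 0)
    (h3' : (k' / d' + m' / d') % 3 = 0) (h2' : (m' / d') % 2 = 0)
    (g : Polynomial ℚ)
    (h : (X : Polynomial ℚ) ^ k - X ^ m - 1 = (X ^ (2 * d) - X ^ d + 1) * g)
    (h' : (X : Polynomial ℚ) ^ k' - X ^ m' - 1 = (X ^ (2 * d') - X ^ d' + 1) * g) :
    k = k' ∧ m = m' := by
  obtain ⟨p, q⟩ := cof_aux2 k m d hm hd h2
  obtain ⟨p', q'⟩ := cof_aux2 k' m' d' hm' hd' h2'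
  rcases lt_trichotomy d d' with hlt | heq | hlt
  · exact (cof_aux k m k' m' d d' p q hkm q' hkm' hlt g h h').elim
  · clear hd hd'
    subst heq
    have e := h.trans h'.symm
    have key : ∀ a b : ℕ, 0 < b → b < a → ∀ n, ((X : Polynomial ℚ) ^ a - X ^ b - 1).coeff n
        = (if n = a then 1 else 0) - (if n = b then 1 else 0) - (if n = 0 then 1 else 0) := by
      intro a b _ _ n
      simp [coeff_X_pow, coeff_one]
    have c1 := key k m hm hkm k
    have c2 := key k m hm hkm m
    rw [e, key k' m' hm' hkm'] at c1 c2
    have hk : k = k' := by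
      by_contra hne
      rw [if_neg hne, if_pos rfl, if_neg (by omega : ¬ k = 0), if_neg (by omega : ¬ k = m)] at c1
      split_ifs at c1 <;> norm_num at c1
    refine ⟨hk, ?_⟩
    by_contra hne
    rw [if_neg hne, if_pos rfl, if_neg (by omega : ¬ m = 0), if_neg (by omega : ¬ m = k),
      if_neg (by omega : ¬ m = k')] at c2
    norm_num at c2
  · exact (cof_aux k' m' k m d' d p' q' hkm' q hkm hlt g h' h).elim
end

section
/- Let n and r, s, t be integers with 1 ≤ r ≤ s ≤ t < n and r + s + t = 2n. Then the function x ↦ x^n − x^{n−r} − x^{n−s} − x^{n−t} − 2 is strictly increasing on the interval [1, ∞), and it has exactly one real root greater than 1. -/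
/-- The characteristic polynomial of a Type 5 digraph is strictly increasing
on [1, ∞) and has exactly one real root greater than 1. -/
theorem type5_char_poly_strictMonoOn (n r s t : ℕ)
    (hr : 1 ≤ r) (hrs : r ≤ s) (hst : s ≤ t) (htn : t < n)
    (hsum : r + s + t = 2 * n) :
    StrictMonoOn
      (fun x : ℝ => x ^ n - x ^ (n - r) - x ^ (n - s) - x ^ (n - t) - 2)
      (Set.Ici 1) ∧
    (∃! x : ℝ, 1 < x ∧ x ^ n - x ^ (n - r) - x ^ (n - s) - x ^ (n - t) - 2 = 0) := by
  obtain ⟨a, ha⟩ : ∃ a, a = n - r := ⟨_, rfl⟩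
  obtain ⟨b, hb⟩ : ∃ b, b = n - s := ⟨_, rfl⟩
  obtain ⟨c, hc⟩ : ∃ c, c = n - t := ⟨_, rfl⟩
  rw [← ha, ← hb, ← hc]
  have ha1 : 1 ≤ a := by omega
  have hb1 : 1 ≤ b := by omega
  have hc1 : 1 ≤ c := by omega
  have hn : n = a + b + c := by omega
  have hcont : Continuous (fun x : ℝ => x ^ n - x ^ a - x ^ b - x ^ c - 2) := by fun_prop
  have hmono : StrictMonoOn (fun x : ℝ => x ^ n - x ^ a - x ^ b - x ^ c - 2) (Set.Ici 1) := by
    apply strictMonoOn_of_deriv_pos (convex_Ici 1) hcont.continuousOn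
    intro x hx
    rw [interior_Ici] at hx
    have hx1 : (1 : ℝ) < x := hx
    have hd : HasDerivAt (fun x : ℝ => x ^ n - x ^ a - x ^ b - x ^ c - 2)
        (n * x ^ (n - 1) - a * x ^ (a - 1) - b * x ^ (b - 1) - c * x ^ (c - 1)) x :=
      ((((hasDerivAt_pow n x).sub (hasDerivAt_pow a x)).sub (hasDerivAt_pow b x)).sub
        (hasDerivAt_pow c x)).sub_const 2
    rw [hd.deriv]
    have key : ∀ k : ℕ, 1 ≤ k → k < n → 0 < (k : ℝ) * (x ^ (n - 1) - x ^ (k - 1)) := by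
      intro k hk hkn
      have h1 : x ^ (k - 1) < x ^ (n - 1) := pow_lt_pow_right₀ hx1 (by omega)
      have h2 : (0 : ℝ) < k := by exact_mod_cast hk
      exact mul_pos h2 (by linarith)
    have h1 := key a ha1 (by omega)
    have h2 := key b hb1 (by omega)
    have h3 := key c hc1 (by omega)
    have hnr : (n : ℝ) = a + b + c := by exact_mod_cast hn
    rw [hnr]
    linarith
  refine ⟨hmono, ?_⟩
  have h3 : (0 : ℝ) ≤ (3 : ℝ) ^ n - 3 ^ a - 3 ^ b - 3 ^ c - 2 := by
    have key : ∀ k : ℕ, 1 ≤ k → (3 : ℝ) ≤ 3 ^ k := fun k hk =>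
      le_self_pow₀ (by norm_num) (by omega)
    have h1 := key a ha1
    have h2 := key b hb1
    have h3 := key c hc1
    rw [hn, pow_add, pow_add]
    generalize (3 : ℝ) ^ a = A at *
    generalize (3 : ℝ) ^ b = B at *
    generalize (3 : ℝ) ^ c = C at *
    have e1 : 9 ≤ B * C := by nlinarith
    have e2 : 9 ≤ A * C := by nlinarith
    have e3 : 9 ≤ A * B := by nlinarith
    nlinarith [mul_le_mul_of_nonneg_left e1 (by linarith : 0 ≤ A),
      mul_le_mul_of_nonneg_left e2 (by linarith : 0 ≤ B),
      mul_le_mul_of_nonneg_left e3 (by linarith : 0 ≤ C)]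
  obtain ⟨x, hx, hx0⟩ := intermediate_value_Icc (by norm_num : (1 : ℝ) ≤ 3) hcont.continuousOn
    (show (0 : ℝ) ∈ Set.Icc _ _ from ⟨by norm_num, h3⟩)
  have hx0' : x ^ n - x ^ a - x ^ b - x ^ c - 2 = 0 := hx0
  refine ⟨x, ⟨lt_of_le_of_ne hx.1 ?_, hx0'⟩, ?_⟩
  · rintro rfl
    norm_num at hx0'
  · rintro y ⟨hy, hy0⟩
    exact hmono.injOn (Set.mem_Ici.2 hy.le) (Set.mem_Ici.2 hx.1) (hy0.trans hx0'.symm)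
end
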